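/- Assume Assumption A. If Y ∈ 𝓒 is a nonnegative supermartingale and X ∈ 𝓜 is a martingale with X_0 = 0 such that Y+X is nonnegative, then Ē(Y+X) = Y_0. -/

import Mathlib

open MeasureTheory Filter Set
open scoped ENNReal NNReal Topology

noncomputable section

namespace ModelFreeBDG

/-- A martingale space: a filtration `F` on `Ω` (with `F 0` trivial) together with
finitely many basic continuous martingales `S j`, each adapted with all trajectories
continuous.  Time is indexed by `ℝ≥0`. -/
structure MartingaleSpace (Ω : Type*) where
  F : ℝ≥0 → MeasurableSpace Ω
  mono : Monotone F
  F0_trivial : F 0 = ⊥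
  d : ℕ
  S : Fin d → ℝ≥0 → Ω → ℝ
  S_adapted : ∀ j t, Measurable[F t] fun ω => S j t ω
  S_cont : ∀ j ω, Continuous fun t => S j t ω

variable {Ω : Type*}

/-- A stopping time w.r.t. the filtration of `M`, with values in `[0,∞]`. -/
def MartingaleSpace.IsStoppingTime (M : MartingaleSpace Ω) (τ : Ω → ℝ≥0∞) : Prop :=
  ∀ t : ℝ≥0, MeasurableSet[M.F t] {ω | τ ω ≤ (t : ℝ≥0∞)}

/-- `g` is measurable with respect to the σ-field `F_τ` generated by the stopping time `τ`. -/
def MartingaleSpace.MeasStopped (M : MartingaleSpace Ω) (τ : Ω → ℝ≥0∞) (g : Ω → ℝ) : Prop :=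
  ∀ B : Set ℝ, MeasurableSet B → ∀ t : ℝ≥0,
    MeasurableSet[M.F t] {ω | g ω ∈ B ∧ τ ω ≤ (t : ℝ≥0∞)}

/-- A proper sequence of stopping times: nondecreasing, starting from `0`, and on each path
either divergent to `+∞` or eventually constant. -/
structure ProperSeq (M : MartingaleSpace Ω) where
  τ : ℕ → Ω → ℝ≥0∞
  stopping : ∀ n, M.IsStoppingTime (τ n)
  mono : ∀ ω, Monotone fun n => τ n ω
  zero : ∀ ω, τ 0 ω = 0
  proper : ∀ ω, Tendsto (fun n => τ n ω) atTop (𝓝 ⊤) ∨ ∃ n, ∀ m, n ≤ m → τ m ω = τ n ω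

/-- A simple trading strategy. -/
structure SimpleStrategy (M : MartingaleSpace Ω) where
  c : ℝ
  τ : ProperSeq M
  g : ℕ → Ω → ℝ
  g_bdd : ∀ n, ∃ C : ℝ, ∀ ω, |g n ω| ≤ C
  g_meas : ∀ n, M.MeasStopped (τ.τ n) (g n)
  g_top : ∀ n ω, τ.τ n ω = ⊤ → g n ω = 0

/-- `τ(ω) ∧ t`, as an element of `ℝ≥0`. -/
def stopMin (τ : Ω → ℝ≥0∞) (t : ℝ≥0) (ω : Ω) : ℝ≥0 :=
  (min (τ ω) (t : ℝ≥0∞)).toNNReal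

/-- The simple integral `(G·X)_t = c + Σ_{n≥1} g_{n-1}(X_{τ_n∧t} - X_{τ_{n-1}∧t})` for a
real process `X`. -/
def SimpleStrategy.integral {M : MartingaleSpace Ω} (G : SimpleStrategy M)
    (X : ℝ≥0 → Ω → ℝ) (t : ℝ≥0) (ω : Ω) : ℝ :=
  G.c + ∑' n : ℕ,
    G.g n ω * (X (stopMin (G.τ.τ (n + 1)) t ω) ω - X (stopMin (G.τ.τ n) t ω) ω)

/-- A simple capital process: a finite sum `Σ_{j} (G^j · S^j)` over simple trading strategies. -/
def IsSimpleCapital (M : MartingaleSpace Ω) (X : ℝ≥0 → Ω → ℝ) : Prop :=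
  ∃ G : Fin M.d → SimpleStrategy M, ∀ t ω, X t ω = ∑ j, (G j).integral (M.S j) t ω

/-- The class `𝓒` of nonnegative supermartingales: the smallest class of `[-∞,∞]`-valued
processes containing all nonnegative simple capital processes, closed under adding a simple
capital process whenever the sum stays nonnegative, and closed under pointwise `liminf`. -/
inductive IsNonnegSupermart (M : MartingaleSpace Ω) : (ℝ≥0 → Ω → EReal) → Prop
  | simple (X : ℝ≥0 → Ω → ℝ) (hX : IsSimpleCapital M X) (hpos : ∀ t ω, 0 ≤ X t ω) :
      IsNonnegSupermart M fun t ω => (X t ω : EReal)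
  | add (X : ℝ≥0 → Ω → EReal) (Y : ℝ≥0 → Ω → ℝ) (hX : IsNonnegSupermart M X)
      (hY : IsSimpleCapital M Y) (hpos : ∀ t ω, 0 ≤ X t ω + (Y t ω : EReal)) :
      IsNonnegSupermart M fun t ω => X t ω + (Y t ω : EReal)
  | liminf (Xs : ℕ → ℝ≥0 → Ω → EReal) (hXs : ∀ n, IsNonnegSupermart M (Xs n)) :
      IsNonnegSupermart M fun t ω => Filter.liminf (fun n => Xs n t ω) atTop

/-- The upper expectation `Ē Y` of a generalized process `Y`: the infimum of the (deterministic)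
initial values of nonnegative supermartingales dominating `Y`. -/
def upperExp (M : MartingaleSpace Ω) (Y : ℝ≥0 → Ω → EReal) : EReal :=
  sInf {x : EReal | ∃ X, IsNonnegSupermart M X ∧ (∀ ω, X 0 ω = x) ∧
    ∀ t ω, Y t ω ≤ X t ω}

/-- The outer measure `P̄ A := Ē 1_A` of a set of pairs `(t, ω)`. -/
def upperProb (M : MartingaleSpace Ω) (A : Set (ℝ≥0 × Ω)) : EReal :=
  upperExp M fun t ω => A.indicator (fun _ => (1 : EReal)) (t, ω)

/-- A set `E ⊆ [0,∞) × Ω` is instantly enforceable if some nonnegative supermartingale with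
initial value `1` becomes `+∞` outside of `E`. -/
def InstantlyEnforceable (M : MartingaleSpace Ω) (E : Set (ℝ≥0 × Ω)) : Prop :=
  ∃ X, IsNonnegSupermart M X ∧ (∀ ω, X 0 ω = 1) ∧
    ∀ t ω, (t, ω) ∉ E → X t ω = ⊤

/-- A set is instantly blockable iff its complement is instantly enforceable. -/
def InstantlyBlockable (M : MartingaleSpace Ω) (B : Set (ℝ≥0 × Ω)) : Prop :=
  InstantlyEnforceable M Bᶜ

/-- Assumption A: for any `t ≥ 0` and any instantly blockable set `B`, the projection of
`B ∩ ([0,t] × Ω)` onto `Ω` belongs to `F t`. -/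
def AssumptionA (M : MartingaleSpace Ω) : Prop :=
  ∀ (t : ℝ≥0) (B : Set (ℝ≥0 × Ω)), InstantlyBlockable M B →
    MeasurableSet[M.F t] {ω | ∃ s : ℝ≥0, s ≤ t ∧ (s, ω) ∈ B}

/-- The values of `X` are real w.i.e. -/
def RealWIE (M : MartingaleSpace Ω) (X : ℝ≥0 → Ω → EReal) : Prop :=
  InstantlyEnforceable M {p : ℝ≥0 × Ω | ∃ r : ℝ, X p.1 p.2 = (r : EReal)}

/-- The set of `(t,ω)` where `sup_{s ∈ [0,t]} |X_s(ω) - X^n_s(ω)| → 0` as `n → ∞`. -/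
def unifConvSet (Xn : ℕ → ℝ≥0 → Ω → EReal) (X : ℝ≥0 → Ω → EReal) : Set (ℝ≥0 × Ω) :=
  {p | Tendsto (fun n => ⨆ s ∈ Icc (0 : ℝ≥0) p.1, (X s p.2 - Xn n s p.2).abs)
    atTop (𝓝 (0 : ℝ≥0∞))}

/-- The class `𝓜` of martingales: the smallest class of adapted, real w.i.e. processes
containing all simple capital processes and closed under locally uniform limits w.i.e. -/
inductive IsMartingale (M : MartingaleSpace Ω) : (ℝ≥0 → Ω → EReal) → Prop
  | simple (X : ℝ≥0 → Ω → ℝ) (hX : IsSimpleCapital M X) :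
      IsMartingale M fun t ω => (X t ω : EReal)
  | lim (Xn : ℕ → ℝ≥0 → Ω → EReal) (X : ℝ≥0 → Ω → EReal)
      (hXn : ∀ n, IsMartingale M (Xn n))
      (hadapted : ∀ t, Measurable[M.F t] (X t))
      (hreal : RealWIE M X)
      (hconv : InstantlyEnforceable M (unifConvSet Xn X)) :
      IsMartingale M X

/-- `X_{τ ∧ t}(ω)`. -/
def stopVal (X : ℝ≥0 → Ω → EReal) (τ : Ω → ℝ≥0∞) (t : ℝ≥0) (ω : Ω) : EReal :=
  X (stopMin τ t ω) ω

/-- The simple quadratic variation `[X]^τ_t := Σ_{n≥1} (X_{τ_n∧t} - X_{τ_{n-1}∧t})²`,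
as an element of `[0,∞]`. -/
def sqVarAlong (X : ℝ≥0 → Ω → EReal) (τ : ℕ → Ω → ℝ≥0∞) (t : ℝ≥0) (ω : Ω) : ℝ≥0∞ :=
  ∑' n : ℕ, ((stopVal X (τ (n + 1)) t ω - stopVal X (τ n) t ω) ^ 2).abs

/-- `Y^{τ,*}_t := sup_n |Y_{τ_n ∧ t}|`, as an element of `[0,∞]`. -/
def supAlong (Y : ℝ≥0 → Ω → EReal) (τ : ℕ → Ω → ℝ≥0∞) (t : ℝ≥0) (ω : Ω) : ℝ≥0∞ :=
  ⨆ n : ℕ, (stopVal Y (τ n) t ω).abs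

/-- The supremum process `Y^*_t := sup_{0 ≤ s ≤ t} |Y_s|`, as an element of `[0,∞]`. -/
def supProc (Y : ℝ≥0 → Ω → EReal) (t : ℝ≥0) (ω : Ω) : ℝ≥0∞ :=
  ⨆ s ∈ Icc (0 : ℝ≥0) t, (Y s ω).abs

/-- The hitting time `σ(X,c) := inf {t ≥ 0 : |X_t| ≥ c}`. -/
def hitting (X : ℝ≥0 → Ω → EReal) (c : ℝ) (ω : Ω) : ℝ≥0∞ :=
  ⨅ t ∈ {t : ℝ≥0 | ENNReal.ofReal c ≤ (X t ω).abs}, (t : ℝ≥0∞)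

/-- The oscillation of the trajectory of `X` on `[a,b]`. -/
def oscOn (X : ℝ≥0 → Ω → EReal) (a b : ℝ≥0) (ω : Ω) : EReal :=
  (⨆ s ∈ Icc a b, X s ω) - ⨅ s ∈ Icc a b, X s ω

/-- The set of `(t,ω)` on which the sequence `σ` finely covers `X` with accuracy `δ`:
only finitely many `σ_n(ω) ≤ t`, and the oscillation of `X(ω)` on each interval
`[σ_n(ω)∧t, σ_{n+1}(ω)∧t]` is at most `δ`. -/
def fineCoverSet (σ : ℕ → Ω → ℝ≥0∞) (X : ℝ≥0 → Ω → EReal) (δ : ℝ) : Set (ℝ≥0 × Ω) :=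
  {p | {n : ℕ | σ n p.2 ≤ (p.1 : ℝ≥0∞)}.Finite ∧
    ∀ n, oscOn X (stopMin (σ n) p.1 p.2) (stopMin (σ (n + 1)) p.1 p.2) p.2 ≤ (δ : EReal)}

/-- `σ` is a fine cover of `X` with accuracy `δ` on the set `E`. -/
def FinelyCoversOn (M : MartingaleSpace Ω) (σ : ℕ → Ω → ℝ≥0∞) (X : ℝ≥0 → Ω → EReal)
    (δ : ℝ) (E : Set (ℝ≥0 × Ω)) : Prop :=
  (∀ n, M.IsStoppingTime (σ n)) ∧ (∀ ω, Monotone fun n => σ n ω) ∧ (∀ ω, σ 0 ω = 0) ∧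
    E ⊆ fineCoverSet σ X δ

/-- `σ` is a fine cover of `X` with accuracy `δ` w.i.e. -/
def ProperSeq.FinelyCoversWIE {M : MartingaleSpace Ω} (σ : ProperSeq M)
    (X : ℝ≥0 → Ω → EReal) (δ : ℝ) : Prop :=
  InstantlyEnforceable M (fineCoverSet σ.τ X δ)

/-- The set of `(t,ω)` on which `sup_{s ∈ [0, σ(ω) ∧ t]} |Y^m_s(ω) - Y_s(ω)| → 0`, i.e.
locally uniform convergence on the random interval `[0,σ]∖{+∞}`. -/
def convWithinSet (Ym : ℕ → ℝ≥0 → Ω → EReal) (Y : ℝ≥0 → Ω → EReal) (σ : Ω → ℝ≥0∞) :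
    Set (ℝ≥0 × Ω) :=
  {p | Tendsto (fun m => ⨆ s ∈ Icc (0 : ℝ≥0) (stopMin σ p.1 p.2),
    (Ym m s p.2 - Y s p.2).abs) atTop (𝓝 (0 : ℝ≥0∞))}

/-- The set of `(t,ω)` on which `sup_{s ∈ [0,t]} |Y^m_s(ω) - Y_s(ω)| → 0`, i.e. locally
uniform convergence. -/
def locUnifConvSet (Ym : ℕ → ℝ≥0 → Ω → EReal) (Y : ℝ≥0 → Ω → EReal) : Set (ℝ≥0 × Ω) :=
  {p | Tendsto (fun m => ⨆ s ∈ Icc (0 : ℝ≥0) p.1, (Ym m s p.2 - Y s p.2).abs)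
    atTop (𝓝 (0 : ℝ≥0∞))}

/-- `Q` is a quadratic variation of `X`: a real continuous adapted process such that, for every
summable sequence of positive accuracies `δ_m` and every sequence of proper sequences of
stopping times `σ^m` finely covering `X` with accuracy `δ_m` w.i.e., and every `c > 0`, the
simple quadratic variations `[X]^{σ^m}` converge locally uniformly on `[0, σ(X,c)]∖{+∞}`
w.i.e. to `Q`. -/
structure IsQuadVar (M : MartingaleSpace Ω) (X : ℝ≥0 → Ω → EReal) (Q : ℝ≥0 → Ω → ℝ) :
    Prop where
  adapted : ∀ t, Measurable[M.F t] (Q t)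
  cont : ∀ ω, Continuous fun t => Q t ω
  conv : ∀ δ : ℕ → ℝ, (∀ m, 0 < δ m) → Summable δ →
    ∀ σ : ℕ → ProperSeq M, (∀ m, (σ m).FinelyCoversWIE X (δ m)) →
    ∀ c : ℝ, 0 < c →
      InstantlyEnforceable M (convWithinSet
        (fun m t ω => ((sqVarAlong X (σ m).τ t ω : ℝ≥0∞) : EReal))
        (fun t ω => ((Q t ω : ℝ) : EReal)) (hitting X c))

open Classical in
/-- The Lebesgue–Stieltjes measure on `ℝ` associated with a monotone continuous function
(and the zero measure otherwise). -/
def lsMeasure (a : ℝ → ℝ) : Measure ℝ :=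
  if h : Monotone a ∧ Continuous a then
    StieltjesFunction.measure ⟨a, h.1, fun _ => h.2.continuousWithinAt⟩
  else 0

/-- The pathwise Lebesgue–Stieltjes integral `∫_0^t g dа` for functions on `ℝ≥0`. -/
def lsInt (g : ℝ≥0 → ℝ) (a : ℝ≥0 → ℝ) (t : ℝ≥0) : ℝ :=
  ∫ s in Ioc (0 : ℝ) (t : ℝ), g s.toNNReal ∂(lsMeasure fun s => a s.toNNReal)

/-- The pathwise Lebesgue–Stieltjes integral `∫_0^t g d(¼ Qp − ¼ Qm)`, i.e. the integral
with respect to a quadratic covariation `[X,Y] = ¼[X+Y] − ¼[X−Y]`. -/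
def covIntegral (g : ℝ≥0 → ℝ) (Qp Qm : ℝ≥0 → ℝ) (t : ℝ≥0) : ℝ :=
  (1 / 4 : ℝ) * lsInt g Qp t - (1 / 4 : ℝ) * lsInt g Qm t

/-- The step process associated with a simple trading strategy:
`G_t = Σ_{n≥1} g_{n-1} 1_{[τ_{n-1}, τ_n)}(t)`. -/
def SimpleStrategy.step {M : MartingaleSpace Ω} (G : SimpleStrategy M) (t : ℝ≥0) (ω : Ω) :
    ℝ :=
  ∑' n : ℕ, ({t' : ℝ≥0 | G.τ.τ n ω ≤ (t' : ℝ≥0∞) ∧ (t' : ℝ≥0∞) < G.τ.τ (n + 1) ω}).indicator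
    (fun _ => G.g n ω) t

/-- The simple integral `(G·X)` of a simple trading strategy against an `EReal`-valued
process. -/
def SimpleStrategy.integralE {M : MartingaleSpace Ω} (G : SimpleStrategy M)
    (X : ℝ≥0 → Ω → EReal) (t : ℝ≥0) (ω : Ω) : EReal :=
  (G.c : EReal) + ∑' n : ℕ,
    (G.g n ω : EReal) * (stopVal X (G.τ.τ (n + 1)) t ω - stopVal X (G.τ.τ n) t ω)

/-- Membership in the space `𝓡` of generalized processes whose trajectories are Borel
measurable and real on every interval `[0,t]` w.i.e. -/
def MemR (M : MartingaleSpace Ω) (G : ℝ≥0 → Ω → EReal) : Prop :=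
  InstantlyEnforceable M {p : ℝ≥0 × Ω |
    (∀ s ∈ Icc (0 : ℝ≥0) p.1, ∃ r : ℝ, G s p.2 = (r : EReal)) ∧
    Measurable ((Icc (0 : ℝ≥0) p.1).restrict fun s => G s p.2)}

/-- The pseudo-distance `d_{∞,X,loc}(Y,Z) := Σ_{N≥1} 2^{-N} Ē((Y−Z)^*_{·∧σ(X,N)})`. -/
def dInfLoc (M : MartingaleSpace Ω) (X : ℝ≥0 → Ω → EReal) (Y Z : ℝ≥0 → Ω → EReal) :
    EReal :=
  ∑' N : ℕ, (((1 / 2 : ℝ) ^ (N + 1) : ℝ) : EReal) *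
    upperExp M (fun t ω =>
      ((⨆ s ∈ Icc (0 : ℝ≥0) (stopMin (hitting X ((N : ℝ) + 1)) t ω),
        (Y s ω - Z s ω).abs : ℝ≥0∞) : EReal))

/-- The approximating stopping times `τ^m_n` for a càdlàg integrand `G`:
`τ^m_0 = 0`, `τ^m_{n+1} = inf{t > τ^m_n : |G_t − G_{τ^m_n}| ≥ 2^{-m}}`. -/
def approxTimes (G : ℝ≥0 → Ω → ℝ) (m : ℕ) : ℕ → Ω → ℝ≥0∞
  | 0 => fun _ => 0
  | n + 1 => fun ω =>
      ⨅ t ∈ {t : ℝ≥0 | approxTimes G m n ω < (t : ℝ≥0∞) ∧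
        ((2 : ℝ) ^ m)⁻¹ ≤ |G t ω - G ((approxTimes G m n ω).toNNReal) ω|}, (t : ℝ≥0∞)

/-- The approximating simple integral `(G^m · X)` where
`G^m_t = Σ_{n≥1} G_{τ^m_{n-1}} 1_{[τ^m_{n-1}, τ^m_n)}(t)`. -/
def approxInt (G : ℝ≥0 → Ω → ℝ) (X : ℝ≥0 → Ω → EReal) (m : ℕ) (t : ℝ≥0) (ω : Ω) :
    EReal :=
  ∑' n : ℕ, ((G ((approxTimes G m n ω).toNNReal) ω : ℝ) : EReal) *
    (stopVal X (approxTimes G m (n + 1)) t ω - stopVal X (approxTimes G m n) t ω)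

/-- `I` is a model-free integral `G·X`: a representative of the `d_{∞,X,loc}`-limit of the
classes of the approximating simple integrals `G^m·X`. -/
def IsModelFreeIntegral (M : MartingaleSpace Ω) (X : ℝ≥0 → Ω → EReal) (G : ℝ≥0 → Ω → ℝ)
    (I : ℝ≥0 → Ω → EReal) : Prop :=
  Tendsto (fun m => dInfLoc M X (approxInt G X m) I) atTop (𝓝 (0 : EReal))

/-- The filtration of `M` is right-continuous. -/
def RightContinuousFiltration (M : MartingaleSpace Ω) : Prop :=
  ∀ t : ℝ≥0, M.F t = ⨅ (s : ℝ≥0) (_ : t < s), M.F s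

/-- A càdlàg function on `ℝ≥0`. -/
def IsCadlag (f : ℝ≥0 → ℝ) : Prop :=
  (∀ t, ContinuousWithinAt f (Ici t) t) ∧
    ∀ t : ℝ≥0, 0 < t → ∃ l : ℝ, Tendsto f (𝓝[<] t) (𝓝 l)

/-- The truncated variation `TV^c(x,[0,t])` of a function `x : ℝ≥0 → ℝ`. -/
def truncVar (x : ℝ≥0 → ℝ) (c : ℝ) (t : ℝ≥0) : ℝ≥0∞ :=
  ⨆ (n : ℕ) (u : Fin (n + 1) → ℝ≥0) (_ : Monotone u) (_ : ∀ i, u i ≤ t),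
    ∑ i : Fin n, ENNReal.ofReal (|x (u i.succ) - x (u i.castSucc)| - c)


theorem stopMin_coe (τ : Ω → ℝ≥0∞) (t : ℝ≥0) (ω : Ω) :
    ((stopMin τ t ω : ℝ≥0) : ℝ≥0∞) = min (τ ω) (t : ℝ≥0∞) := by
  unfold stopMin
  exact ENNReal.coe_toNNReal (ne_top_of_le_ne_top ENNReal.coe_ne_top (min_le_right _ _))

theorem stopMin_le (τ : Ω → ℝ≥0∞) (t : ℝ≥0) (ω : Ω) : stopMin τ t ω ≤ t := by
  rw [← ENNReal.coe_le_coe, stopMin_coe]; exact min_le_right _ _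

theorem stopMin_le_tau (τ : Ω → ℝ≥0∞) (t : ℝ≥0) (ω : Ω) :
    ((stopMin τ t ω : ℝ≥0) : ℝ≥0∞) ≤ τ ω := by
  rw [stopMin_coe]; exact min_le_left _ _

theorem stopMin_of_le (τ : Ω → ℝ≥0∞) (t : ℝ≥0) (ω : Ω) (h : (t : ℝ≥0∞) ≤ τ ω) :
    stopMin τ t ω = t := by
  rw [← ENNReal.coe_inj, stopMin_coe, min_eq_right h]

theorem stopMin_zero (τ : Ω → ℝ≥0∞) (ω : Ω) : stopMin τ 0 ω = 0 :=
  le_antisymm (stopMin_le _ _ _) zero_le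

theorem stopMin_stopMin (τ σ : Ω → ℝ≥0∞) (t : ℝ≥0) (ω : Ω) :
    stopMin τ (stopMin σ t ω) ω = stopMin (fun ω => min (τ ω) (σ ω)) t ω := by
  rw [← ENNReal.coe_inj, stopMin_coe, stopMin_coe, stopMin_coe, min_assoc]

theorem stopMin_cont (τ : Ω → ℝ≥0∞) (ω : Ω) : Continuous fun t => stopMin τ t ω := by
  rcases eq_or_ne (τ ω) ⊤ with h | h
  · have : (fun t => stopMin τ t ω) = fun t => t := by
      funext t; exact stopMin_of_le _ _ _ (by rw [h]; exact le_top)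
    rw [this]; exact continuous_id
  · have : (fun t => stopMin τ t ω) = fun t => min (τ ω).toNNReal t := by
      funext t
      rw [← ENNReal.coe_inj, stopMin_coe, ENNReal.coe_min, ENNReal.coe_toNNReal h]
    rw [this]; fun_prop

theorem stopMin_meas (M : MartingaleSpace Ω) {τ : Ω → ℝ≥0∞} (hτ : M.IsStoppingTime τ)
    (t : ℝ≥0) : Measurable[M.F t] (stopMin τ t) := by
  let _ := M.F t
  refine measurable_of_Iic fun a => ?_
  by_cases h : t ≤ a
  · convert MeasurableSet.univ using 1
    ext ω; simp only [mem_preimage, mem_Iic, mem_univ, iff_true]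
    exact (stopMin_le _ _ _).trans h
  · have : stopMin τ t ⁻¹' Iic a = {ω | τ ω ≤ (a : ℝ≥0∞)} := by
      ext ω
      simp only [mem_preimage, mem_Iic, mem_ofPred_eq]
      rw [← ENNReal.coe_le_coe, stopMin_coe, min_le_iff]
      simp [h]
    rw [this]
    exact M.mono (le_of_not_ge h) _ (hτ a)

theorem stopping_min (M : MartingaleSpace Ω) {τ σ : Ω → ℝ≥0∞} (hτ : M.IsStoppingTime τ)
    (hσ : M.IsStoppingTime σ) : M.IsStoppingTime fun ω => min (τ ω) (σ ω) := by
  intro t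
  have : {ω | min (τ ω) (σ ω) ≤ (t : ℝ≥0∞)} = {ω | τ ω ≤ (t : ℝ≥0∞)} ∪ {ω | σ ω ≤ (t : ℝ≥0∞)} := by
    ext ω; simp
  rw [this]
  exact @MeasurableSet.union _ (M.F t) _ _ (hτ t) (hσ t)

theorem stopping_const (M : MartingaleSpace Ω) (c : ℝ≥0∞) : M.IsStoppingTime fun _ => c := by
  intro t
  exact @MeasurableSet.const _ (M.F t) _

theorem stopped_meas (M : MartingaleSpace Ω) {τ : Ω → ℝ≥0∞} (hτ : M.IsStoppingTime τ)
    (j : Fin M.d) (t : ℝ≥0) : Measurable[M.F t] fun ω => M.S j (stopMin τ t ω) ω := by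
  let _ := M.F t
  have h1 : Measurable (Function.uncurry fun (s : ℝ≥0) (ω : Ω) => M.S j (min s t) ω) := by
    apply measurable_uncurry_of_continuous_of_measurable
    · intro ω
      exact (M.S_cont j ω).comp (continuous_id.min continuous_const)
    · intro s
      exact (M.S_adapted j (min s t)).mono (M.mono (min_le_right _ _)) le_rfl
  have h2 : Measurable fun ω => (stopMin τ t ω, ω) := (stopMin_meas M hτ t).prodMk measurable_id
  have h3 := h1.comp h2
  convert h3 using 1
  funext ω
  simp [Function.uncurry, min_eq_left (stopMin_le τ t ω)]

theorem proper_const {M : MartingaleSpace Ω} (P : ProperSeq M) (T : ℝ≥0) (ω : Ω) :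
    ∃ N, ∀ n, N ≤ n → ∀ t ≤ T, stopMin (P.τ (n + 1)) t ω = stopMin (P.τ n) t ω := by
  rcases P.proper ω with h | ⟨N, h⟩
  · have h1 : ∀ᶠ n in atTop, (T : ℝ≥0∞) < P.τ n ω :=
      h.eventually (lt_mem_nhds ENNReal.coe_lt_top)
    obtain ⟨N, hN⟩ := eventually_atTop.1 h1
    refine ⟨N, fun n hn t ht => ?_⟩
    have ht' : (t : ℝ≥0∞) ≤ T := ENNReal.coe_le_coe.2 ht
    rw [stopMin_of_le _ _ _ (ht'.trans (hN n hn).le),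
      stopMin_of_le _ _ _ (ht'.trans (hN (n+1) (by omega)).le)]
  · refine ⟨N, fun n hn t _ => ?_⟩
    rw [← ENNReal.coe_inj, stopMin_coe, stopMin_coe, h n hn, h (n+1) (by omega)]

theorem integral_eq_fin {M : MartingaleSpace Ω} (G : SimpleStrategy M) (X : ℝ≥0 → Ω → ℝ)
    (T : ℝ≥0) (ω : Ω) : ∃ N, ∀ m, N ≤ m → ∀ t ≤ T, G.integral X t ω = G.c + ∑ n ∈ Finset.range m,
      G.g n ω * (X (stopMin (G.τ.τ (n + 1)) t ω) ω - X (stopMin (G.τ.τ n) t ω) ω) := by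
  obtain ⟨N, hN⟩ := proper_const G.τ T ω
  refine ⟨N, fun m hm t ht => ?_⟩
  unfold SimpleStrategy.integral
  rw [tsum_eq_sum (s := Finset.range m)]
  intro n hn
  rw [hN n (by simp at hn; omega) t ht]; simp

theorem integral_zero {M : MartingaleSpace Ω} (G : SimpleStrategy M) (X : ℝ≥0 → Ω → ℝ)
    (ω : Ω) : G.integral X 0 ω = G.c := by
  simp [SimpleStrategy.integral, stopMin_zero]

theorem integral_cont {M : MartingaleSpace Ω} (G : SimpleStrategy M) (j : Fin M.d)
    (T : ℝ≥0) (ω : Ω) : ContinuousOn (fun t => G.integral (M.S j) t ω) (Icc 0 T) := by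
  obtain ⟨N, hN⟩ := integral_eq_fin G (M.S j) T ω
  refine ContinuousOn.congr (Continuous.continuousOn ?_) fun t ht => hN N le_rfl t ht.2
  refine continuous_const.add (continuous_finsetSum _ fun n _ => continuous_const.mul ?_)
  exact ((M.S_cont j ω).comp (stopMin_cont _ ω)).sub ((M.S_cont j ω).comp (stopMin_cont _ ω))

theorem integral_meas {M : MartingaleSpace Ω} (G : SimpleStrategy M) (j : Fin M.d)
    (t : ℝ≥0) : Measurable[M.F t] (G.integral (M.S j) t) := by
  let _ := M.F t
  refine measurable_of_tendsto_metrizable (f := fun m ω => G.c + ∑ n ∈ Finset.range m,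
      G.g n ω * (M.S j (stopMin (G.τ.τ (n + 1)) t ω) ω - M.S j (stopMin (G.τ.τ n) t ω) ω)) ?_ ?_
  · intro m
    refine measurable_const.add (Finset.measurable_fun_sum _ fun n _ => ?_)
    have hg : Measurable fun ω => {ω | G.τ.τ n ω ≤ (t : ℝ≥0∞)}.indicator (G.g n) ω := by
      intro B hB
      have h1 := G.g_meas n B hB t
      by_cases h0 : (0 : ℝ) ∈ B
      · convert MeasurableSet.union h1 (G.τ.stopping n t).compl using 1
        ext ω
        by_cases h : G.τ.τ n ω ≤ (t : ℝ≥0∞) <;> simp [indicator, h, h0]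
      · convert h1 using 1
        ext ω
        by_cases h : G.τ.τ n ω ≤ (t : ℝ≥0∞) <;> simp [indicator, h, h0]
    have h2 := hg.mul ((stopped_meas M (G.τ.stopping (n+1)) j t).sub
      (stopped_meas M (G.τ.stopping n) j t))
    convert h2 using 1
    funext ω
    by_cases h : G.τ.τ n ω ≤ (t : ℝ≥0∞)
    · simp [indicator, h]
    · have h' := (not_le.1 h).le
      have h'' := h'.trans (G.τ.mono ω (Nat.le_succ n))
      simp [stopMin_of_le _ _ _ h', stopMin_of_le _ _ _ h'']
  · rw [tendsto_pi_nhds]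
    intro ω
    obtain ⟨N, hN⟩ := integral_eq_fin G (M.S j) t ω
    exact tendsto_const_nhds.congr' (eventually_atTop.2 ⟨N, fun m hm => hN m hm t le_rfl⟩)

theorem lt_meas (M : MartingaleSpace Ω) {τ σ : Ω → ℝ≥0∞} (hτ : M.IsStoppingTime τ)
    (hσ : M.IsStoppingTime σ) (t : ℝ≥0) :
    MeasurableSet[M.F t] {ω | τ ω ≤ σ ω ∧ τ ω ≤ (t : ℝ≥0∞)} := by
  let _ := M.F t
  have h1 : MeasurableSet {ω | stopMin τ t ω ≤ stopMin σ t ω} :=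
    measurableSet_le (stopMin_meas M hτ t) (stopMin_meas M hσ t)
  convert h1.inter (hτ t) using 1
  ext ω
  simp only [mem_ofPred_eq, mem_inter_iff]
  refine and_congr_left fun h => ?_
  rw [← ENNReal.coe_le_coe, stopMin_coe, stopMin_coe, min_eq_left h]
  simp [h]

open Classical in
def stopStrat {M : MartingaleSpace Ω} (G : SimpleStrategy M) (τ : Ω → ℝ≥0∞)
    (hτ : M.IsStoppingTime τ) : SimpleStrategy M where
  c := G.c
  τ :=
    { τ := fun n ω => min (G.τ.τ n ω) (τ ω)
      stopping := fun n => stopping_min M (G.τ.stopping n) hτ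
      mono := fun ω m n h => min_le_min_right _ (G.τ.mono ω h)
      zero := fun ω => by simp [G.τ.zero ω]
      proper := fun ω => by
        rcases G.τ.proper ω with h | ⟨n, h⟩
        · rcases eq_or_ne (τ ω) ⊤ with h' | h'
          · left; simpa [h'] using h
          · right
            have h1 : ∀ᶠ n in atTop, τ ω < G.τ.τ n ω :=
              h.eventually (lt_mem_nhds (lt_top_iff_ne_top.2 h'))
            obtain ⟨N, hN⟩ := eventually_atTop.1 h1
            refine ⟨N, fun m hm => ?_⟩
            rw [min_eq_right (hN m hm).le, min_eq_right (hN N le_rfl).le]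
        · right
          exact ⟨n, fun m hm => by rw [h m hm]⟩ }
  g := fun n ω => if G.τ.τ n ω ≤ τ ω then G.g n ω else 0
  g_bdd := fun n => by
    obtain ⟨C, hC⟩ := G.g_bdd n
    refine ⟨C, fun ω => ?_⟩
    split_ifs
    · exact hC ω
    · simpa using (abs_nonneg _).trans (hC ω)
  g_meas := fun n B hB t => by
    let _ := M.F t
    have h1 := lt_meas M (G.τ.stopping n) hτ t
    have h2 := G.g_meas n B hB t
    by_cases h0 : (0 : ℝ) ∈ B
    · convert MeasurableSet.union (h1.inter h2) ((hτ t).diff h1) using 1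
      ext ω
      by_cases h : G.τ.τ n ω ≤ τ ω
      · simp [h]
        constructor
        · rintro ⟨a, b | b⟩
          · tauto
          · have := h.trans b; tauto
        · rintro (b | ⟨b, b'⟩)
          · tauto
          · exact absurd (h.trans b) (not_le.2 b')
      · have h' := not_le.1 h
        simp [h, h0]
        intro a; exact h'.le.trans a
    · convert h1.inter h2 using 1
      ext ω
      by_cases h : G.τ.τ n ω ≤ τ ω
      · simp [h]
        constructor
        · rintro ⟨a, b | b⟩
          · tauto
          · have := h.trans b; tauto
        · tauto
      · simp [h, h0]
  g_top := fun n ω h => by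
    have : G.τ.τ n ω = ⊤ := top_le_iff.1 (h ▸ min_le_left _ _)
    simp [G.g_top n ω this]

theorem stopStrat_integral {M : MartingaleSpace Ω} (G : SimpleStrategy M) (τ : Ω → ℝ≥0∞)
    (hτ : M.IsStoppingTime τ) (X : ℝ≥0 → Ω → ℝ) (t : ℝ≥0) (ω : Ω) :
    (stopStrat G τ hτ).integral X t ω = G.integral X (stopMin τ t ω) ω := by
  unfold SimpleStrategy.integral
  congr 1
  refine tsum_congr fun n => ?_
  rw [stopMin_stopMin, stopMin_stopMin]
  simp only [stopStrat]
  split_ifs with h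
  · rfl
  · have h1 := (not_le.1 h).le
    have h2 := h1.trans (G.τ.mono ω (Nat.le_succ n))
    have : stopMin (fun ω => min (G.τ.τ (n+1) ω) (τ ω)) t ω
        = stopMin (fun ω => min (G.τ.τ n ω) (τ ω)) t ω := by
      rw [← ENNReal.coe_inj, stopMin_coe, stopMin_coe, min_eq_right h1, min_eq_right h2]
    rw [this]; simp

theorem capital_stop {M : MartingaleSpace Ω} {X : ℝ≥0 → Ω → ℝ} (hX : IsSimpleCapital M X)
    {τ : Ω → ℝ≥0∞} (hτ : M.IsStoppingTime τ) :
    IsSimpleCapital M fun t ω => X (stopMin τ t ω) ω := by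
  obtain ⟨G, hG⟩ := hX
  refine ⟨fun j => stopStrat (G j) τ hτ, fun t ω => ?_⟩
  simp only [stopStrat_integral, hG]

def scaleStrat {M : MartingaleSpace Ω} (G : SimpleStrategy M) (a b : ℝ) : SimpleStrategy M where
  c := a * G.c + b
  τ := G.τ
  g := fun n ω => a * G.g n ω
  g_bdd := fun n => by
    obtain ⟨C, hC⟩ := G.g_bdd n
    exact ⟨|a| * C, fun ω => by rw [abs_mul]; gcongr; exact hC ω⟩
  g_meas := fun n B hB t =>
    G.g_meas n ((fun x => a * x) ⁻¹' B) (measurable_const_mul a hB) t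
  g_top := fun n ω h => by simp [G.g_top n ω h]

theorem scaleStrat_integral {M : MartingaleSpace Ω} (G : SimpleStrategy M) (a b : ℝ)
    (X : ℝ≥0 → Ω → ℝ) (t : ℝ≥0) (ω : Ω) :
    (scaleStrat G a b).integral X t ω = a * G.integral X t ω + b := by
  simp only [SimpleStrategy.integral, scaleStrat, mul_assoc, tsum_mul_left]
  ring

def zeroStrat (M : MartingaleSpace Ω) : SimpleStrategy M where
  c := 0
  τ :=
    { τ := fun _ _ => 0
      stopping := fun _ => stopping_const M 0
      mono := fun _ => monotone_const
      zero := fun _ => rfl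
      proper := fun _ => Or.inr ⟨0, fun _ _ => rfl⟩ }
  g := fun _ _ => 0
  g_bdd := fun _ => ⟨0, fun _ => by simp⟩
  g_meas := fun _ B _ t => @MeasurableSet.const _ (M.F t) ((0:ℝ) ∈ B ∧ (0:ℝ≥0∞) ≤ t)
  g_top := fun _ _ _ => rfl

theorem capital_zero (M : MartingaleSpace Ω) : IsSimpleCapital M fun _ _ => 0 :=
  ⟨fun _ => zeroStrat M, fun t ω => by simp [SimpleStrategy.integral, zeroStrat]⟩

theorem capital_scale {M : MartingaleSpace Ω} {X : ℝ≥0 → Ω → ℝ} (hX : IsSimpleCapital M X)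
    (a : ℝ) : IsSimpleCapital M fun t ω => a * X t ω := by
  obtain ⟨G, hG⟩ := hX
  refine ⟨fun j => scaleStrat (G j) a 0, fun t ω => ?_⟩
  simp [scaleStrat_integral, hG, Finset.mul_sum]

theorem capital_addc {M : MartingaleSpace Ω} (hd : M.d ≠ 0) {X : ℝ≥0 → Ω → ℝ}
    (hX : IsSimpleCapital M X) (b : ℝ) : IsSimpleCapital M fun t ω => X t ω + b := by
  obtain ⟨G, hG⟩ := hX
  have hd' : (M.d : ℝ) ≠ 0 := by exact_mod_cast hd
  refine ⟨fun j => scaleStrat (G j) 1 (b / M.d), fun t ω => ?_⟩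
  simp [scaleStrat_integral, hG, Finset.sum_add_distrib]
  field_simp

theorem capital_const {M : MartingaleSpace Ω} (hd : M.d ≠ 0) (b : ℝ) :
    IsSimpleCapital M fun _ _ => b := by
  simpa using capital_addc hd (capital_zero M) b

theorem capital_init {M : MartingaleSpace Ω} {X : ℝ≥0 → Ω → ℝ} (hX : IsSimpleCapital M X)
    (ω ω' : Ω) : X 0 ω = X 0 ω' := by
  obtain ⟨G, hG⟩ := hX
  simp [hG, integral_zero]

theorem capital_meas {M : MartingaleSpace Ω} {X : ℝ≥0 → Ω → ℝ} (hX : IsSimpleCapital M X)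
    (t : ℝ≥0) : Measurable[M.F t] (X t) := by
  obtain ⟨G, hG⟩ := hX
  let _ := M.F t
  have : X t = fun ω => ∑ j, (G j).integral (M.S j) t ω := funext fun ω => hG t ω
  rw [this]
  exact Finset.measurable_fun_sum _ fun j _ => integral_meas (G j) j t

theorem capital_cont {M : MartingaleSpace Ω} {X : ℝ≥0 → Ω → ℝ} (hX : IsSimpleCapital M X)
    (T : ℝ≥0) (ω : Ω) : ContinuousOn (fun t => X t ω) (Icc 0 T) := by
  obtain ⟨G, hG⟩ := hX
  simp only [hG]
  exact continuousOn_finsetSum _ fun j _ => integral_cont (G j) j T ω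

theorem sm_nonneg {M : MartingaleSpace Ω} {X : ℝ≥0 → Ω → EReal} (hX : IsNonnegSupermart M X) :
    ∀ t ω, 0 ≤ X t ω := by
  induction hX with
  | simple X hX hpos => intro t ω; exact EReal.coe_nonneg.2 (hpos t ω)
  | add X Y hX hY hpos ih => exact hpos
  | liminf Xs hXs ih =>
    intro t ω
    exact le_liminf_of_le (by isBoundedDefault) (Eventually.of_forall fun n => ih n t ω)

theorem sm_init {M : MartingaleSpace Ω} {X : ℝ≥0 → Ω → EReal} (hX : IsNonnegSupermart M X) :
    ∀ ω ω', X 0 ω = X 0 ω' := by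
  induction hX with
  | simple X hX hpos => intro ω ω'; dsimp only; rw [capital_init hX ω ω']
  | add X Y hX hY hpos ih => intro ω ω'; dsimp only; rw [capital_init hY ω ω', ih ω ω']
  | liminf Xs hXs ih =>
    intro ω ω'
    simp only [fun n => ih n ω ω']

theorem sm_stop {M : MartingaleSpace Ω} {X : ℝ≥0 → Ω → EReal} (hX : IsNonnegSupermart M X)
    {τ : Ω → ℝ≥0∞} (hτ : M.IsStoppingTime τ) :
    IsNonnegSupermart M fun t ω => X (stopMin τ t ω) ω := by
  induction hX with
  | simple X hX hpos => exact .simple _ (capital_stop hX hτ) fun t ω => hpos _ _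
  | add X Y hX hY hpos ih => exact .add _ _ ih (capital_stop hY hτ) fun t ω => hpos _ _
  | liminf Xs hXs ih => exact .liminf _ ih

theorem sm_congr {M : MartingaleSpace Ω} {X X' : ℝ≥0 → Ω → EReal} (hX : IsNonnegSupermart M X)
    (h : ∀ t ω, X' t ω = X t ω) : IsNonnegSupermart M X' := by
  have : X' = X := by funext t ω; exact h t ω
  rwa [this]

theorem sm_add {M : MartingaleSpace Ω} {X Y : ℝ≥0 → Ω → EReal} (hX : IsNonnegSupermart M X)
    (hY : IsNonnegSupermart M Y) : IsNonnegSupermart M fun t ω => X t ω + Y t ω := by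
  have hYn := sm_nonneg hY
  induction hX with
  | simple X hX hpos =>
    refine sm_congr (.add _ _ hY hX fun t ω => ?_) fun t ω => add_comm _ _
    exact add_nonneg (hYn t ω) (by exact_mod_cast hpos t ω)
  | add X S hX hS hpos ih =>
    have e : ∀ t ω, X t ω + (S t ω : EReal) + Y t ω = X t ω + Y t ω + (S t ω : EReal) :=
      fun t ω => add_right_comm _ _ _
    refine sm_congr (.add _ _ ih hS fun t ω => ?_) e
    rw [← e]; exact add_nonneg (hpos t ω) (hYn t ω)
  | liminf Xs hXs ih =>
    refine sm_congr (.liminf _ ih) fun t ω => ?_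
    have hnn : ∀ n, 0 ≤ Xs n t ω := fun n => sm_nonneg (hXs n) t ω
    have hl : 0 ≤ Filter.liminf (fun n => Xs n t ω) atTop :=
      le_liminf_of_le (by isBoundedDefault) (Eventually.of_forall hnn)
    have hy := hYn t ω
    have key := Monotone.map_liminf_of_continuousAt (F := (atTop : Filter ℕ))
      (f := fun x : EReal => x + Y t ω) (fun a b h => by dsimp only; gcongr) (fun n => Xs n t ω)
      (by
        refine ContinuousAt.comp (f := fun x : EReal => (x, Y t ω))
          (g := fun p : EReal × EReal => p.1 + p.2) (EReal.continuousAt_add ?_ ?_) (by fun_prop)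
        · right; exact ne_bot_of_le_ne_bot (by simp) hy
        · left; exact ne_bot_of_le_ne_bot (by simp) hl)
      (by isBoundedDefault) (by isBoundedDefault)
    exact key

theorem sm_scale {M : MartingaleSpace Ω} {X : ℝ≥0 → Ω → EReal} (hX : IsNonnegSupermart M X)
    {a : ℝ} (ha : 0 < a) : IsNonnegSupermart M fun t ω => (a : EReal) * X t ω := by
  have ha' : (0 : EReal) ≤ (a : EReal) := by exact_mod_cast ha.le
  induction hX with
  | simple X hX hpos =>
    refine sm_congr (.simple _ (capital_scale hX a) fun t ω => mul_nonneg ha.le (hpos t ω)) ?_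
    intro t ω; push_cast; rfl
  | add X S hX hS hpos ih =>
    have e : ∀ t ω, (a : EReal) * (X t ω + (S t ω : EReal))
        = (a : EReal) * X t ω + ((a * S t ω : ℝ) : EReal) := by
      intro t ω
      rw [EReal.left_distrib_of_nonneg_of_ne_top ha' (EReal.coe_ne_top a)]; push_cast; rfl
    refine sm_congr (.add _ _ ih (capital_scale hS a) fun t ω => ?_) e
    rw [← e]; exact mul_nonneg ha' (hpos t ω)
  | liminf Xs hXs ih =>
    refine sm_congr (.liminf _ ih) fun t ω => ?_
    have key := Monotone.map_liminf_of_continuousAt (F := (atTop : Filter ℕ))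
      (f := fun x : EReal => (a : EReal) * x) (fun x y h => mul_le_mul_of_nonneg_left h ha')
      (fun n => Xs n t ω)
      (by
        refine ContinuousAt.comp (f := fun x : EReal => ((a : EReal), x))
          (g := fun p : EReal × EReal => p.1 * p.2) (EReal.continuousAt_mul ?_ ?_ ?_ ?_)
          (by fun_prop)
        all_goals simp [ha.ne'])
      (by isBoundedDefault) (by isBoundedDefault)
    exact key

def Enf (M : MartingaleSpace Ω) (E : Set (ℝ≥0 × Ω)) : Prop :=
  ∀ ε : ℝ, 0 < ε → ∃ W, IsNonnegSupermart M W ∧ (∀ ω, W 0 ω ≤ (ε : EReal)) ∧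
    ∀ t ω, (t, ω) ∉ E → W t ω = ⊤

theorem enf_of {M : MartingaleSpace Ω} {E : Set (ℝ≥0 × Ω)} (h : InstantlyEnforceable M E) :
    Enf M E := by
  obtain ⟨W, hW, h0, h1⟩ := h
  intro ε hε
  refine ⟨_, sm_scale hW hε, fun ω => by simp [h0], fun t ω h => ?_⟩
  simp only [h1 t ω h]
  exact EReal.coe_mul_top_of_pos hε

theorem enf_mono {M : MartingaleSpace Ω} {E E' : Set (ℝ≥0 × Ω)} (h : Enf M E) (hs : E ⊆ E') :
    Enf M E' := by
  intro ε hε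
  obtain ⟨W, hW, h0, h1⟩ := h ε hε
  exact ⟨W, hW, h0, fun t ω h => h1 t ω fun h' => h (hs h')⟩

theorem sm_zero (M : MartingaleSpace Ω) : IsNonnegSupermart M fun _ _ => 0 :=
  .simple _ (capital_zero M) fun _ _ => le_rfl

theorem enf_univ (M : MartingaleSpace Ω) : Enf M univ := by
  intro ε hε
  refine ⟨_, sm_zero M, fun ω => ?_, fun t ω h => absurd (mem_univ _) h⟩
  exact_mod_cast hε.le

theorem sm_sum {M : MartingaleSpace Ω} {W : ℕ → ℝ≥0 → Ω → EReal}
    (hW : ∀ n, IsNonnegSupermart M (W n)) (N : ℕ) :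
    IsNonnegSupermart M fun t ω => ∑ n ∈ Finset.range N, W n t ω := by
  induction N with
  | zero => simpa using sm_zero M
  | succ N ih => simpa only [Finset.sum_range_succ] using sm_add ih (hW N)

theorem enf_iInter {M : MartingaleSpace Ω} {E : ℕ → Set (ℝ≥0 × Ω)} (h : ∀ n, Enf M (E n)) :
    Enf M (⋂ n, E n) := by
  intro ε hε
  choose W hW h0 h1 using fun n => h n (ε * (1 / 2) ^ (n + 1)) (by positivity)
  refine ⟨_, .liminf _ (sm_sum hW), fun ω => ?_, fun t ω h => ?_⟩
  · refine liminf_le_of_frequently_le' (Frequently.of_forall fun N => ?_)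
    have : ∑ n ∈ Finset.range N, W n 0 ω ≤ ((ε * (1 - (1 / 2) ^ N) : ℝ) : EReal) := by
      induction N with
      | zero => simp
      | succ N ih =>
        rw [Finset.sum_range_succ]
        refine (add_le_add ih (h0 N ω)).trans ?_
        rw [← EReal.coe_add, EReal.coe_le_coe_iff, pow_succ]
        apply le_of_eq; ring
    refine this.trans ?_
    rw [EReal.coe_le_coe_iff]
    have : (0 : ℝ) ≤ ε * (1 / 2) ^ N := by positivity
    linarith
  · simp only [mem_iInter, not_forall] at h
    obtain ⟨n, hn⟩ := h
    refine top_le_iff.1 (le_liminf_of_le (by isBoundedDefault) (eventually_atTop.2 ⟨n + 1, ?_⟩))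
    intro N hN
    rw [← h1 n t ω hn]
    exact Finset.single_le_sum (f := fun n => W n t ω) (fun i _ => sm_nonneg (hW i) t ω)
      (Finset.mem_range.2 (by omega))

theorem enf_inter {M : MartingaleSpace Ω} {E E' : Set (ℝ≥0 × Ω)} (h : Enf M E) (h' : Enf M E') :
    Enf M (E ∩ E') := by
  refine enf_mono (enf_iInter (E := fun n => if n = 0 then E else E') fun n => ?_) ?_
  · split_ifs <;> assumption
  · intro p hp
    rw [mem_iInter] at hp
    exact ⟨by simpa using hp 0, by simpa using hp 1⟩

theorem enf_zero {M : MartingaleSpace Ω} {E : Set (ℝ≥0 × Ω)} (h : Enf M E) (ω : Ω) :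
    ((0 : ℝ≥0), ω) ∈ E := by
  by_contra hc
  obtain ⟨W, hW, h0, h1⟩ := h 1 one_pos
  have := h0 ω
  rw [h1 0 ω hc] at this
  exact absurd (top_le_iff.1 this) (EReal.coe_ne_top _)

theorem inst_of_enf {M : MartingaleSpace Ω} [Nonempty Ω] (hd : M.d ≠ 0) {E : Set (ℝ≥0 × Ω)}
    (h : Enf M E) : InstantlyEnforceable M E := by
  obtain ⟨W, hW, h0, h1⟩ := h 1 one_pos
  obtain ⟨ω₀⟩ := ‹Nonempty Ω›
  obtain ⟨r, hr⟩ : ∃ r : ℝ, W 0 ω₀ = r := by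
    refine ⟨(W 0 ω₀).toReal, (EReal.coe_toReal ?_ ?_).symm⟩
    · exact ne_top_of_le_ne_top (EReal.coe_ne_top _) (h0 ω₀)
    · exact ne_bot_of_le_ne_bot (by simp) (sm_nonneg hW 0 ω₀)
  have hr1 : r ≤ 1 := by
    have := h0 ω₀
    rw [hr] at this
    exact_mod_cast this
  refine ⟨_, .add W _ hW (capital_const hd (1 - r)) fun t ω => ?_, fun ω => ?_, fun t ω h => ?_⟩
  · exact add_nonneg (sm_nonneg hW t ω) (EReal.coe_nonneg.2 (by linarith))
  · rw [sm_init hW ω ω₀, hr, ← EReal.coe_add]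
    simp
  · rw [h1 t ω h]; exact EReal.top_add_coe _

theorem subset_meas {M : MartingaleSpace Ω} (hA : AssumptionA M) (hd : M.d ≠ 0)
    {E : Set (ℝ≥0 × Ω)} (h : Enf M E) (t : ℝ≥0) (A : Set Ω) (hAE : ∀ ω ∈ A, (t, ω) ∉ E) :
    MeasurableSet[M.F t] A := by
  rcases isEmpty_or_nonempty Ω with hΩ | hΩ
  · rw [Set.eq_empty_of_isEmpty A]; exact @MeasurableSet.empty _ (M.F t)
  · have h1 : InstantlyBlockable M {p : ℝ≥0 × Ω | p.1 = t ∧ p.2 ∈ A} := by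
      refine inst_of_enf hd (enf_mono h ?_)
      rintro ⟨s, ω⟩ hp ⟨h1, h2⟩
      dsimp only at h1 h2
      subst h1
      exact hAE ω h2 hp
    convert hA t _ h1 using 1
    ext ω
    simp

theorem exists_hit {M : MartingaleSpace Ω} (hA : AssumptionA M) (hd : M.d ≠ 0)
    {E : Set (ℝ≥0 × Ω)} (hE : Enf M E) (hdown : ∀ t s ω, s ≤ t → (t, ω) ∈ E → (s, ω) ∈ E)
    (f : ℝ≥0 → Ω → ℝ) (hf : ∀ t, Measurable[M.F t] (f t))
    (hc : ∀ t ω, (t, ω) ∈ E → ContinuousOn (fun s => f s ω) (Icc 0 t)) (ε : ℝ)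
    (hf0 : ∀ ω, f 0 ω ≤ ε) :
    ∃ τ, M.IsStoppingTime τ ∧ ∀ t ω, (t, ω) ∈ E →
      (∀ s : ℝ≥0, s ≤ t → (s : ℝ≥0∞) ≤ τ ω → f s ω ≤ ε) ∧
      ((∀ s, s ≤ t → f s ω < ε) → (t : ℝ≥0∞) ≤ τ ω) := by
  set τ : Ω → ℝ≥0∞ := fun ω => ⨅ t ∈ {t : ℝ≥0 | (t, ω) ∈ E ∧ ε ≤ f t ω}, (t : ℝ≥0∞) with hτ
  have hlt : ∀ (s : ℝ≥0) ω, (s, ω) ∈ E → (s : ℝ≥0∞) < τ ω → f s ω < ε := by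
    intro s ω hs h
    by_contra hcon
    exact absurd (iInf₂_le (f := fun (t : ℝ≥0) (_ : t ∈ {t : ℝ≥0 | (t, ω) ∈ E ∧ ε ≤ f t ω}) =>
      (t : ℝ≥0∞)) s ⟨hs, not_lt.1 hcon⟩) (not_le.2 h)
  have hcc : ∀ t ω, (t, ω) ∈ E → Continuous fun s => f (min s t) ω := by
    intro t ω h
    exact (hc t ω h).comp_continuous (continuous_id.min continuous_const)
      fun s => ⟨zero_le, min_le_right _ _⟩
  have hiff : ∀ t ω, (t, ω) ∈ E → (τ ω ≤ (t : ℝ≥0∞) ↔ ∃ s ≤ t, ε ≤ f s ω) := by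
    intro t ω h
    constructor
    · intro hle
      by_contra! hcon
      have hft : f t ω < ε := hcon t le_rfl
      rcases hle.lt_or_eq with hl | heq
      · simp only [hτ, iInf_lt_iff] at hl
        obtain ⟨s, ⟨_, hs⟩, hst⟩ := hl
        exact absurd (hcon s (ENNReal.coe_le_coe.1 hst.le)) (not_lt.2 hs)
      · have : τ ω < ⊤ := heq ▸ ENNReal.coe_lt_top
        simp only [hτ, iInf_lt_iff] at this
        obtain ⟨u, ⟨huE, hu⟩, _⟩ := this
        have htu : t < u := by
          by_contra hh
          exact absurd (hcon u (not_lt.1 hh)) (not_lt.2 hu)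
        have hev : ∀ᶠ s in 𝓝 t, f (min s u) ω < ε := by
          refine (hcc u ω huE).continuousAt.eventually_lt_const ?_
          simpa only [min_eq_left htu.le] using hft
        obtain ⟨v, hv, hv'⟩ := exists_Ico_subset_of_mem_nhds hev ⟨u, htu⟩
        · have : τ ω < ((min v u : ℝ≥0) : ℝ≥0∞) := by
            rw [heq]; exact ENNReal.coe_lt_coe.2 (lt_min hv htu)
          simp only [hτ, iInf_lt_iff] at this
          obtain ⟨s, ⟨hsE, hs⟩, hsv⟩ := this
          rw [ENNReal.coe_lt_coe, lt_min_iff] at hsv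
          rcases le_total s t with hst | hst
          · exact absurd (hcon s hst) (not_lt.2 hs)
          · have : f (min s u) ω < ε := hv' ⟨hst, hsv.1⟩
            rw [min_eq_left hsv.2.le] at this
            linarith
    · rintro ⟨s, hs, hfs⟩
      exact (iInf₂_le (f := fun (t : ℝ≥0) (_ : t ∈ {t : ℝ≥0 | (t, ω) ∈ E ∧ ε ≤ f t ω}) =>
        (t : ℝ≥0∞)) s ⟨hdown t s ω hs h, hfs⟩).trans (ENNReal.coe_le_coe.2 hs)
  refine ⟨τ, fun t => ?_, fun t ω h => ⟨fun s hs hsτ => ?_, fun hs => ?_⟩⟩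
  · let _ := M.F t
    have h1 : MeasurableSet {ω | (t, ω) ∉ E} :=
      subset_meas hA hd hE t _ fun ω h => h
    have h2 : MeasurableSet {ω | τ ω ≤ (t : ℝ≥0∞) ∧ (t, ω) ∉ E} :=
      subset_meas hA hd hE t _ fun ω h => h.2
    have h3 : MeasurableSet (⋂ k : ℕ, ⋃ i : ℕ,
        {ω | ε - 1 / ((k : ℝ) + 1) < f (min (TopologicalSpace.denseSeq ℝ≥0 i) t) ω}) := by
      refine MeasurableSet.iInter fun k => MeasurableSet.iUnion fun i => ?_
      exact measurableSet_lt measurable_const ((hf _).mono (M.mono (min_le_right _ _)) le_rfl)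
    convert h2.union (h1.compl.inter h3) using 1
    ext ω
    by_cases hω : (t, ω) ∈ E
    · simp only [mem_union, mem_inter_iff, mem_compl_iff, mem_ofPred_eq, hω, not_true_eq_false,
        and_false, false_or, not_false_eq_true, true_and, mem_iInter, mem_iUnion, hiff t ω hω]
      constructor
      · rintro ⟨s, hs, hfs⟩ k
        have ho : IsOpen {s | ε - 1 / ((k : ℝ) + 1) < f (min s t) ω} :=
          isOpen_lt continuous_const (hcc t ω hω)
        have hk : (0 : ℝ) < 1 / ((k : ℝ) + 1) := by positivity
        obtain ⟨x, hx⟩ := (TopologicalSpace.denseRange_denseSeq ℝ≥0).exists_mem_open ho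
          ⟨s, by simp only [mem_ofPred_eq, min_eq_left hs]; linarith⟩
        exact ⟨x, hx⟩
      · intro hk
        obtain ⟨s, hs, hmax⟩ := isCompact_Icc.exists_isMaxOn (nonempty_Icc.2 (zero_le : (0:ℝ≥0) ≤ t))
          (hc t ω hω)
        refine ⟨s, hs.2, ?_⟩
        refine le_of_forall_pos_lt_add fun δ hδ => ?_
        obtain ⟨k, hkδ⟩ := exists_nat_one_div_lt hδ
        obtain ⟨i, hi⟩ := hk k
        have := hmax (⟨zero_le, min_le_right _ _⟩ :
          min (TopologicalSpace.denseSeq ℝ≥0 i) t ∈ Icc 0 t)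
        simp only [mem_ofPred_eq] at this
        linarith
    · simp [hω]
  · rcases eq_or_ne s 0 with rfl | hs0
    · exact hf0 ω
    · have hcs := hc s ω (hdown t s ω hs h)
      have hcl : closure (Ico 0 s) = Icc 0 s := closure_Ico (Ne.symm hs0)
      have := ContinuousWithinAt.closure_le (s := Ico 0 s) (x := s) (f := fun s => f s ω)
        (g := fun _ => ε) (by rw [hcl]; exact ⟨zero_le, le_rfl⟩)
        ((hcs s ⟨zero_le, le_rfl⟩).mono Ico_subset_Icc_self) continuousWithinAt_const
        (fun y hy => (hlt y ω (hdown t y ω (hy.2.le.trans hs) h)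
          ((ENNReal.coe_lt_coe.2 hy.2).trans_le hsτ)).le)
      exact this
  · by_contra hcon
    obtain ⟨s, hs', hfs⟩ := (hiff t ω h).1 (not_le.1 hcon).le
    exact absurd (hs s hs') (not_lt.2 hfs)

def NiceSet (X : ℝ≥0 → Ω → EReal) : Set (ℝ≥0 × Ω) :=
  {p | (∀ s ≤ p.1, ((X s p.2).toReal : EReal) = X s p.2) ∧
    ContinuousOn (fun s => (X s p.2).toReal) (Icc 0 p.1)}

theorem nice_down {X : ℝ≥0 → Ω → EReal} (t s : ℝ≥0) (ω : Ω) (hs : s ≤ t)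
    (h : (t, ω) ∈ NiceSet X) : (s, ω) ∈ NiceSet X :=
  ⟨fun u hu => h.1 u (hu.trans hs), h.2.mono (Icc_subset_Icc_right hs)⟩

theorem conv_down {Xn : ℕ → ℝ≥0 → Ω → EReal} {X : ℝ≥0 → Ω → EReal} (t s : ℝ≥0) (ω : Ω)
    (hs : s ≤ t) (h : (t, ω) ∈ unifConvSet Xn X) : (s, ω) ∈ unifConvSet Xn X := by
  refine tendsto_of_tendsto_of_tendsto_of_le_of_le tendsto_const_nhds h (fun _ => zero_le) ?_
  intro n
  exact biSup_mono fun u hu => ⟨hu.1, hu.2.trans hs⟩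

theorem conv_eventually {Xn : ℕ → ℝ≥0 → Ω → EReal} {X : ℝ≥0 → Ω → EReal} {t : ℝ≥0} {ω : Ω}
    (h : (t, ω) ∈ unifConvSet Xn X) (hn : ∀ n, (t, ω) ∈ NiceSet (Xn n)) {ε : ℝ} (hε : 0 < ε) :
    ∀ᶠ n in atTop, ∀ s ≤ t, ((X s ω).toReal : EReal) = X s ω ∧
      |(X s ω).toReal - (Xn n s ω).toReal| < ε := by
  have h1 : ∀ᶠ n in atTop, (⨆ s ∈ Icc (0 : ℝ≥0) t, (X s ω - Xn n s ω).abs) < ENNReal.ofReal ε :=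
    Tendsto.eventually_lt_const (ENNReal.ofReal_pos.2 hε) h
  filter_upwards [h1] with n h2 s hs
  have h3 : (X s ω - Xn n s ω).abs < ENNReal.ofReal ε :=
    lt_of_le_of_lt (le_iSup₂ (f := fun s (_ : s ∈ Icc (0 : ℝ≥0) t) => (X s ω - Xn n s ω).abs) s
      ⟨zero_le, hs⟩) h2
  have h4 : ((Xn n s ω).toReal : EReal) = Xn n s ω := (hn n).1 s hs
  rw [← h4] at h3
  induction hx : X s ω with
  | bot => rw [hx] at h3; simp at h3
  | top => rw [hx] at h3; simp at h3
  | coe x =>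
    rw [hx, ← EReal.coe_sub, EReal.abs_def] at h3
    exact ⟨rfl, (ENNReal.ofReal_lt_ofReal_iff hε).1 h3⟩

theorem nice_lim {Xn : ℕ → ℝ≥0 → Ω → EReal} {X : ℝ≥0 → Ω → EReal} {t : ℝ≥0} {ω : Ω}
    (h : (t, ω) ∈ unifConvSet Xn X) (hn : ∀ n, (t, ω) ∈ NiceSet (Xn n)) :
    (t, ω) ∈ NiceSet X := by
  refine ⟨fun s hs => ?_, ?_⟩
  · obtain ⟨n, hn⟩ := (conv_eventually h hn one_pos).exists
    exact (hn s hs).1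
  · have : TendstoUniformlyOn (fun n s => (Xn n s ω).toReal) (fun s => (X s ω).toReal) atTop
        (Icc 0 t) := by
      rw [Metric.tendstoUniformlyOn_iff]
      intro ε hε
      filter_upwards [conv_eventually h hn hε] with n h1 s hs
      rw [Real.dist_eq]; exact (h1 s hs.2).2
    exact this.continuousOn (Frequently.of_forall fun n => (hn n).2)

theorem mart_adapted {M : MartingaleSpace Ω} {X : ℝ≥0 → Ω → EReal} (hX : IsMartingale M X) :
    ∀ t, Measurable[M.F t] (X t) := by
  cases hX with
  | simple X hX =>
    intro t
    let _ := M.F t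
    exact measurable_coe_real_ereal.comp (capital_meas hX t)
  | lim Xn X hXn hadapted hreal hconv => exact hadapted

theorem mart_nice {M : MartingaleSpace Ω} {X : ℝ≥0 → Ω → EReal} (hX : IsMartingale M X) :
    Enf M (NiceSet X) := by
  induction hX with
  | simple X hX =>
    refine enf_mono (enf_univ M) ?_
    rintro ⟨t, ω⟩ -
    exact ⟨fun s _ => rfl, capital_cont hX t ω⟩
  | lim Xn X hXn hadapted hreal hconv ih =>
    refine enf_mono (enf_inter (enf_of hconv) (enf_iInter ih)) ?_
    rintro ⟨t, ω⟩ ⟨h1, h2⟩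
    exact nice_lim h1 (mem_iInter.1 h2)

theorem mart_init {M : MartingaleSpace Ω} {X : ℝ≥0 → Ω → EReal} (hX : IsMartingale M X)
    (ω ω' : Ω) : X 0 ω = X 0 ω' := by
  have h := mart_adapted hX 0
  rw [M.F0_trivial] at h
  have h1 := @h {X 0 ω'} (measurableSet_singleton _)
  rcases MeasurableSpace.measurableSet_bot_iff.1 h1 with h2 | h2
  · exact absurd (show ω' ∈ X 0 ⁻¹' {X 0 ω'} from rfl) (by rw [h2]; simp)
  · exact (h2 ▸ mem_univ ω : ω ∈ X 0 ⁻¹' {X 0 ω'})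

theorem coe_cmp (y a b : EReal) (ha : (a.toReal : EReal) = a) (hb : (b.toReal : EReal) = b)
    (c d : ℝ) (h : a.toReal + c ≤ b.toReal + d) :
    y + a + (c : EReal) ≤ y + b + (d : EReal) := by
  rw [add_assoc, add_assoc]
  refine add_le_add le_rfl ?_
  rw [← ha, ← hb, ← EReal.coe_add, ← EReal.coe_add]
  exact EReal.coe_le_coe_iff.2 h

theorem mart_main {M : MartingaleSpace Ω} (hA : AssumptionA M) (hd : M.d ≠ 0)
    {X : ℝ≥0 → Ω → EReal} (hX : IsMartingale M X) :
    ∀ (Y : ℝ≥0 → Ω → EReal) (_ : IsNonnegSupermart M Y) (τ : Ω → ℝ≥0∞)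
      (_ : M.IsStoppingTime τ) (c : ℝ) (E : Set (ℝ≥0 × Ω)) (_ : Enf M E)
      (_ : ∀ t s ω, s ≤ t → (t, ω) ∈ E → (s, ω) ∈ E)
      (_ : ∀ t ω, (t, ω) ∈ E →
        0 ≤ Y (stopMin τ t ω) ω + X (stopMin τ t ω) ω + (c : EReal)) (ε : ℝ) (_ : 0 < ε),
      ∃ Z, IsNonnegSupermart M Z ∧ (∀ ω, Z 0 ω ≤ Y 0 ω + X 0 ω + ((c + ε : ℝ) : EReal)) ∧
        ∀ t ω, Y (stopMin τ t ω) ω + X (stopMin τ t ω) ω + (c : EReal) ≤ Z t ω := by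
  induction hX with
  | simple G hG =>
    intro Y hY τ hτ c E hE hdown hpos ε hε
    obtain ⟨W, hW, hW0, hW1⟩ := hE ε hε
    have hY' := sm_add (sm_stop hY hτ) hW
    have hG' := capital_addc hd (capital_stop hG hτ) c
    have e : ∀ (t : ℝ≥0) (ω : Ω), Y (stopMin τ t ω) ω + W t ω
        + ((G (stopMin τ t ω) ω + c : ℝ) : EReal)
        = Y (stopMin τ t ω) ω + (G (stopMin τ t ω) ω : EReal) + (c : EReal) + W t ω := by
      intro t ω
      rw [EReal.coe_add, add_right_comm, add_assoc (Y _ _) (G _ _ : EReal)]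
    refine ⟨_, .add _ _ hY' hG' fun t ω => ?_, fun ω => ?_, fun t ω => ?_⟩
    · by_cases h : (t, ω) ∈ E
      · rw [e]
        exact add_nonneg (hpos t ω h) (sm_nonneg hW t ω)
      · have h1 : Y (stopMin τ t ω) ω + W t ω = ⊤ := by
          rw [hW1 t ω h]
          exact EReal.add_top_of_ne_bot (ne_bot_of_le_ne_bot (by simp) (sm_nonneg hY _ ω))
        rw [h1, EReal.top_add_coe]; exact le_top
    · dsimp only
      rw [e, stopMin_zero, EReal.coe_add c ε, ← add_assoc]
      gcongr
      exact hW0 ω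
    · dsimp only
      rw [e]
      exact le_add_of_nonneg_right (sm_nonneg hW t ω)
  | lim Xn X hXn hadapted hreal hconv ih =>
    intro Y hY τ hτ c E hE hdown hpos ε hε
    set δ := ε / 4 with hδ
    have hδ0 : 0 < δ := by positivity
    have hXm : IsMartingale M X := .lim Xn X hXn hadapted hreal hconv
    set E' : Set (ℝ≥0 × Ω) := E ∩ (unifConvSet Xn X ∩ ⋂ n, NiceSet (Xn n)) with hE'
    have hE'e : Enf M E' :=
      enf_inter hE (enf_inter (enf_of hconv) (enf_iInter fun n => mart_nice (hXn n)))
    have hE'd : ∀ t s ω, s ≤ t → (t, ω) ∈ E' → (s, ω) ∈ E' := by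
      rintro t s ω hs ⟨h1, h2, h3⟩
      exact ⟨hdown t s ω hs h1, conv_down t s ω hs h2,
        mem_iInter.2 fun n => nice_down t s ω hs (mem_iInter.1 h3 n)⟩
    have hEn : ∀ t ω, (t, ω) ∈ E' → ∀ n, (t, ω) ∈ NiceSet (Xn n) :=
      fun t ω h n => mem_iInter.1 h.2.2 n
    have hEX : ∀ t ω, (t, ω) ∈ E' → (t, ω) ∈ NiceSet X :=
      fun t ω h => nice_lim h.2.1 (hEn t ω h)
    obtain ⟨N, hN⟩ : ∃ N, ∀ n, N ≤ n → ∀ ω, |(X 0 ω).toReal - (Xn n 0 ω).toReal| < δ := by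
      rcases isEmpty_or_nonempty Ω with hΩ | ⟨⟨ω₀⟩⟩
      · exact ⟨0, fun n _ ω => (hΩ.false ω).elim⟩
      · have h0 := enf_zero hE'e ω₀
        obtain ⟨N, hN⟩ := eventually_atTop.1 (conv_eventually h0.2.1 (hEn 0 ω₀ h0) hδ0)
        refine ⟨N, fun n hn ω => ?_⟩
        rw [mart_init hXm ω ω₀, mart_init (hXn n) ω ω₀]
        exact (hN n hn 0 le_rfl).2
    have hstep : ∀ n, ∃ Z, IsNonnegSupermart M Z ∧
        (∀ ω, Z 0 ω ≤ Y 0 ω + X 0 ω + ((c + 3 * δ : ℝ) : EReal)) ∧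
        ∀ t ω, (t, ω) ∈ E' → (∀ s ≤ t, |(X s ω).toReal - (Xn (n + N) s ω).toReal| < δ) →
          Y (stopMin τ t ω) ω + X (stopMin τ t ω) ω + (c : EReal) ≤ Z t ω := by
      intro n
      obtain ⟨σ, hσ, hσ'⟩ := exists_hit hA hd hE'e hE'd
        (fun s ω => |(X s ω).toReal - (Xn (n + N) s ω).toReal|)
        (fun t => by
          let _ := M.F t
          exact ((mart_adapted hXm t).ereal_toReal.sub
            (mart_adapted (hXn (n + N)) t).ereal_toReal).abs)
        (fun t ω h => ((hEX t ω h).2.sub (hEn t ω h (n + N)).2).abs) δ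
        (fun ω => (hN (n + N) (by omega) ω).le)
      have hcmp : ∀ (y : EReal) (s : ℝ≥0) (ω : Ω), (s, ω) ∈ E' →
          |(X s ω).toReal - (Xn (n + N) s ω).toReal| ≤ δ →
          y + X s ω + (c : EReal) ≤ y + Xn (n + N) s ω + ((c + δ : ℝ) : EReal) := by
        intro y s ω h h1
        refine coe_cmp _ _ _ ((hEX s ω h).1 s le_rfl) ((hEn s ω h (n + N)).1 s le_rfl) _ _ ?_
        linarith [(abs_le.1 h1).2]
      obtain ⟨Z, hZ, hZ0, hZ1⟩ := ih (n + N) Y hY (fun ω => min (τ ω) (σ ω)) (stopping_min M hτ hσ)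
        (c + δ) E' hE'e hE'd (by
          intro t ω h
          have hs : stopMin (fun ω => min (τ ω) (σ ω)) t ω ≤ t := stopMin_le _ _ _
          refine le_trans ?_ (hcmp _ _ ω (hE'd t _ ω hs h) ((hσ' t ω h).1 _ hs ?_))
          · rw [← stopMin_stopMin]
            exact hpos _ ω (hdown t _ ω (stopMin_le _ _ _) h.1)
          · exact (stopMin_le_tau _ _ _).trans (min_le_right _ _)) δ hδ0
      refine ⟨Z, hZ, fun ω => (hZ0 ω).trans ?_, fun t ω h h1 => ?_⟩
      · have h0 := enf_zero hE'e ω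
        refine coe_cmp _ _ _ ((hEn 0 ω h0 (n + N)).1 0 le_rfl) ((hEX 0 ω h0).1 0 le_rfl) _ _ ?_
        linarith [(abs_le.1 (hN (n + N) (by omega) ω).le).1]
      · have h2 := hZ1 t ω
        rw [← stopMin_stopMin, stopMin_of_le σ t ω ((hσ' t ω h).2 h1)] at h2
        exact (hcmp _ _ ω (hE'd t _ ω (stopMin_le _ _ _) h) (h1 _ (stopMin_le _ _ _)).le).trans h2
    choose Z hZ hZ0 hZ1 using hstep
    obtain ⟨W, hW, hW0, hW1⟩ := hE'e δ hδ0
    have hL := IsNonnegSupermart.liminf Z hZ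
    refine ⟨_, sm_add hL hW, fun ω => ?_, fun t ω => ?_⟩
    · have h1 : Filter.liminf (fun n => Z n 0 ω) atTop
          ≤ Y 0 ω + X 0 ω + ((c + 3 * δ : ℝ) : EReal) :=
        liminf_le_of_frequently_le' (Frequently.of_forall fun n => hZ0 n ω)
      refine (add_le_add h1 (hW0 ω)).trans ?_
      rw [add_assoc, ← EReal.coe_add]
      apply le_of_eq
      congr 2
      rw [hδ]; ring
    · by_cases h : (t, ω) ∈ E'
      · refine le_trans ?_ (le_add_of_nonneg_right (sm_nonneg hW t ω))
        refine le_liminf_of_le (by isBoundedDefault) ?_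
        have := conv_eventually h.2.1 (hEn t ω h) hδ0
        filter_upwards [(tendsto_add_atTop_nat N).eventually this] with n hn
        exact hZ1 n t ω h fun s hs => (hn s hs).2
      · rw [hW1 t ω h, EReal.add_top_of_ne_bot
          (ne_bot_of_le_ne_bot (by simp) (sm_nonneg hL t ω))]
        exact le_top

theorem mart_zero {M : MartingaleSpace Ω} (hd : M.d = 0) {X : ℝ≥0 → Ω → EReal}
    (hX : IsMartingale M X) (t : ℝ≥0) (ω : Ω) : X t ω = 0 := by
  have hcap : ∀ {S : ℝ≥0 → Ω → ℝ}, IsSimpleCapital M S → ∀ t ω, S t ω = 0 := by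
    rintro S ⟨G, hG⟩ t ω
    rw [hG]
    have : IsEmpty (Fin M.d) := by rw [hd]; infer_instance
    simp
  have hsm : ∀ {W : ℝ≥0 → Ω → EReal}, IsNonnegSupermart M W → ∀ t ω, W t ω = 0 := by
    intro W hW
    induction hW with
    | simple X hX hpos => intro t ω; simp [hcap hX t ω]
    | add X S hX hS hpos ih => intro t ω; simp [hcap hS t ω, ih t ω]
    | liminf Xs hXs ih => intro t ω; simp [fun n => ih n t ω]
  cases hX with
  | simple X hX => simp [hcap hX t ω]
  | lim Xn X hXn hadapted hreal hconv =>
    obtain ⟨W, hW, h0, _⟩ := hreal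
    have := h0 ω
    rw [hsm hW 0 ω] at this
    exact absurd this (by simp)

/-- if `Y ∈ 𝓒`, `X ∈ 𝓜`, `X_0 = 0` and `Y + X` is nonnegative, then
`Ē(Y + X) = Y_0`. -/
theorem upperExp_supermart_add_martingale (M : MartingaleSpace Ω) (hA : AssumptionA M)
    (Y X : ℝ≥0 → Ω → EReal) (hY : IsNonnegSupermart M Y) (hX : IsMartingale M X)
    (hX0 : ∀ ω, X 0 ω = 0) (hpos : ∀ t ω, 0 ≤ Y t ω + X t ω) :
    ∀ ω : Ω, upperExp M (fun t ω' => Y t ω' + X t ω') = Y 0 ω := by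
  intro ω₀
  refine le_antisymm ?_ ?_
  · by_cases hd : M.d = 0
    · refine sInf_le ⟨Y, hY, fun ω => sm_init hY ω ω₀, fun t ω => ?_⟩
      simp [mart_zero hd hX t ω]
    · refine EReal.le_of_forall_lt_iff_le.1 fun z hz => ?_
      have hnn := sm_nonneg hY 0 ω₀
      obtain ⟨y, hy⟩ : ∃ y : ℝ, Y 0 ω₀ = y :=
        ⟨(Y 0 ω₀).toReal, (EReal.coe_toReal (ne_top_of_lt hz)
          (ne_bot_of_le_ne_bot (by simp) hnn)).symm⟩
      rw [hy, EReal.coe_lt_coe_iff] at hz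
      obtain ⟨Z, hZ, hZ0, hZ1⟩ := mart_main hA hd hX Y hY (fun _ => ⊤) (stopping_const M ⊤) 0 univ
        (enf_univ M) (fun _ _ _ _ _ => mem_univ _) (fun t ω _ => by simpa using hpos _ ω)
        (z - y) (by linarith)
      have h1 : Z 0 ω₀ ≤ (z : EReal) := by
        refine (hZ0 ω₀).trans ?_
        rw [hX0, hy, add_zero, ← EReal.coe_add, EReal.coe_le_coe_iff]
        linarith
      refine le_trans (sInf_le ⟨Z, hZ, fun ω => sm_init hZ ω ω₀, fun t ω => ?_⟩) h1
      have h2 := hZ1 t ω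
      rw [stopMin_of_le (fun _ => ⊤) t ω le_top] at h2
      simpa using h2
  · refine le_sInf ?_
    rintro x ⟨Z, hZ, hZ0, hZ1⟩
    have := hZ1 0 ω₀
    dsimp only at this
    rw [hX0, add_zero, hZ0] at this
    exact this

end ModelFreeBDG
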